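/- Let R be a commutative ring, q ∈ R, and g ≥ 2 an integer. Suppose α_0, α_1, …, α_{g−1}, β_0 ∈ R and A_0, A_1, …, A_{2g} ∈ R satisfy the polynomial identity α_0·∑_{i=0}^{2g} A_i t^{i} = (1 − t)(1 − qt)·( ∑_{m=0}^{g−2} α_m·( t^{m} + q^{g−1−m} t^{2(g−1)−m} ) + α_{g−1}·t^{g−1} ) + (q − 1)·β_0·t^{g} in R[t]. Then for every 0 ≤ i ≤ g − 1 one has (q − 1)·α_i = α_0·∑_{j=0}^{i} (q^{i−j+1} − 1)·A_j. -/

import Mathlib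

open Polynomial

theorem Polynomial.sum_range_coeff_one_sub_X_mul {R : Type*} [CommRing R] (p : R[X]) (n : ℕ) :
    ∑ j ∈ Finset.range (n + 1), ((1 - X) * p).coeff j = p.coeff n := by
  induction n with
  | zero => simp [sub_mul]
  | succ n ih =>
    rw [Finset.sum_range_succ, ih]
    simp [sub_mul]

/-- Recovering the coefficients of `p` from those of `(1 - X) * (1 - q * X) * p`. -/
theorem Polynomial.sub_one_mul_coeff_eq_sum {R : Type*} [CommRing R] (q : R) (p : R[X]) (n : ℕ) :
    (q - 1) * p.coeff n = ∑ j ∈ Finset.range (n + 1),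
      (q ^ (n - j + 1) - 1) * ((1 - X) * (1 - C q * X) * p).coeff j := by
  induction n with
  | zero => simp [mul_coeff_zero]
  | succ n ih =>
    have hsum := sum_range_coeff_one_sub_X_mul ((1 - C q * X) * p) (n + 1)
    have hcoeff : ((1 - C q * X) * p).coeff (n + 1) = p.coeff (n + 1) - q * p.coeff n := by
      simp [sub_mul, mul_assoc]
    rw [← mul_assoc, hcoeff] at hsum
    have hstep : ∀ a : ℕ → R, ∑ j ∈ Finset.range (n + 2), (q ^ (n + 1 - j + 1) - 1) * a j =
        q * ∑ j ∈ Finset.range (n + 1), (q ^ (n - j + 1) - 1) * a j +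
          (q - 1) * ∑ j ∈ Finset.range (n + 2), a j := by
      intro a
      rw [Finset.sum_range_succ, Finset.sum_range_succ a, mul_add, ← add_assoc, Finset.mul_sum,
        Finset.mul_sum, ← Finset.sum_add_distrib]
      congr 1
      · refine Finset.sum_congr rfl fun j hj => ?_
        rw [Nat.sub_add_comm (Finset.mem_range_succ_iff.mp hj)]
        ring
      · simp
    rw [hstep, hsum, ← ih]
    ring

/-- The solved form of the system: for `0 ≤ i ≤ g − 1`,
`(q − 1)·α_i = α_0·∑_{j=0}^{i} (q^{i−j+1} − 1)·A_j`
(i.e. `α_i = ((q^{i+1}−1)/(q−1) + ⋯ + (q+1)A_{i−1} + A_i)·α_0` with denominators cleared). -/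
theorem stmt_16 (R : Type*) [CommRing R] (q : R) (g : ℕ) (hg : 2 ≤ g)
    (α : ℕ → R) (β₀ : R) (A : ℕ → R)
    (hid : C (α 0) * (∑ i ∈ Finset.range (2 * g + 1), C (A i) * X ^ i) =
      (1 - X) * (1 - C q * X) *
        ((∑ m ∈ Finset.range (g - 1), C (α m) *
          (X ^ m + C (q ^ (g - 1 - m)) * X ^ (2 * (g - 1) - m))) +
          C (α (g - 1)) * X ^ (g - 1)) +
        C ((q - 1) * β₀) * X ^ g) :
    ∀ i < g, (q - 1) * α i =
      α 0 * ∑ j ∈ Finset.range (i + 1), (q ^ (i - j + 1) - 1) * A j := by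
  intro i hi
  have hcoeff : ((∑ m ∈ Finset.range (g - 1), C (α m) *
      (X ^ m + C (q ^ (g - 1 - m)) * X ^ (2 * (g - 1) - m))) +
      C (α (g - 1)) * X ^ (g - 1)).coeff i = α i := by
    have hterm : ∀ m ∈ Finset.range (g - 1), (C (α m) *
        (X ^ m + C (q ^ (g - 1 - m)) * X ^ (2 * (g - 1) - m))).coeff i =
        if i = m then α m else 0 := by
      intro m hm
      rw [Finset.mem_range] at hm
      have hne : i ≠ 2 * (g - 1) - m := by omega
      rw [coeff_C_mul, coeff_add, coeff_C_mul, coeff_X_pow, coeff_X_pow, if_neg hne]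
      simp
    rw [coeff_add, finsetSum_coeff, Finset.sum_congr rfl hterm, Finset.sum_ite_eq,
      coeff_C_mul, coeff_X_pow]
    rcases Nat.lt_or_ge i (g - 1) with h | h
    · simp [h, h.ne]
    · obtain rfl : i = g - 1 := by omega
      simp
  rw [← hcoeff, sub_one_mul_coeff_eq_sum, Finset.mul_sum]
  refine Finset.sum_congr rfl fun j hj => ?_
  rw [Finset.mem_range] at hj
  have hj' := congrArg (fun p => p.coeff j) hid
  simp only [coeff_C_mul, finsetSum_coeff, coeff_X_pow, mul_ite, mul_one, mul_zero,
    Finset.sum_ite_eq, Finset.mem_range, coeff_add _ (C ((q - 1) * β₀) * X ^ g)] at hj'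
  rw [if_pos (by omega), if_neg (by omega), add_zero] at hj'
  rw [← hj']
  ring
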